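/- (Collapse.) Let G be a graph with finitely many vertices and let v ∈ G⁰ be a regular vertex that does not support a loop of length one. Let E be the graph obtained from G by deleting v and all edges into or out of v, and adding for each pair of edges (e, f) with r(e) = v = s(f) a new edge [ef] with source s(e) and range r(f). Then G ∼_M E. -/

import Mathlib

/-- A directed graph as used in the theory of graph `C*`-algebras:
a type of vertices, a type of edges, and range and source maps. -/
structure CKGraph : Type 1 where
  V : Type
  E : Type
  r : E → V
  s : E → V

namespace CKGraph

/-- An isomorphism of graphs: bijections of vertices and edges intertwining
the range and source maps. -/
structure Iso (G H : CKGraph) where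
  vEquiv : G.V ≃ H.V
  eEquiv : G.E ≃ H.E
  map_r : ∀ e, H.r (eEquiv e) = vEquiv (G.r e)
  map_s : ∀ e, H.s (eEquiv e) = vEquiv (G.s e)

/-- A vertex is a source if it receives no edges. -/
def IsSource (G : CKGraph) (v : G.V) : Prop := ∀ e, G.r e ≠ v

/-- A vertex is a sink if it emits no edges. -/
def IsSink (G : CKGraph) (v : G.V) : Prop := ∀ e, G.s e ≠ v

/-- A vertex is an infinite emitter if it emits infinitely many edges. -/
def IsInfiniteEmitter (G : CKGraph) (v : G.V) : Prop := {e | G.s e = v}.Infinite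

/-- A vertex is regular if it is neither a sink nor an infinite emitter. -/
def Regular (G : CKGraph) (v : G.V) : Prop :=
  (∃ e, G.s e = v) ∧ {e | G.s e = v}.Finite

/-- There is a (nonempty) path from `u` to `v` in `G`. -/
inductive HasPath (G : CKGraph) : G.V → G.V → Prop
  | single (e : G.E) : HasPath G (G.s e) (G.r e)
  | cons (e : G.E) {v : G.V} : HasPath G (G.r e) v → HasPath G (G.s e) v

/-- `G.Geq u v` is the relation `u ≥ v`: `u = v` or there is a path from `u` to `v`. -/
def Geq (G : CKGraph) (u v : G.V) : Prop := u = v ∨ G.HasPath u v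

/-- There is a (nonempty) path from `u` to `v` all of whose vertices lie in `S`. -/
inductive HasPathIn (G : CKGraph) (S : Set G.V) : G.V → G.V → Prop
  | single (e : G.E) : G.s e ∈ S → G.r e ∈ S → HasPathIn G S (G.s e) (G.r e)
  | cons (e : G.E) {v : G.V} : G.s e ∈ S → HasPathIn G S (G.r e) v →
      HasPathIn G S (G.s e) v

/-- The nonempty list of edges `l` is a path from `u` to `v`. -/
def IsPathFromTo (G : CKGraph) (l : List G.E) (u v : G.V) : Prop :=
  ∃ h : l ≠ [], l.Chain' (fun e f => G.r e = G.s f) ∧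
    G.s (l.head h) = u ∧ G.r (l.getLast h) = v

/-- The list of edges `l` is a simple loop based at `v`: a loop at `v` such that the
range of every non-final edge is different from `v`. -/
def IsSimpleLoopAt (G : CKGraph) (v : G.V) (l : List G.E) : Prop :=
  G.IsPathFromTo l v v ∧ ∀ e ∈ l.dropLast, G.r e ≠ v

/-- A set of vertices is hereditary if it contains the range of every edge whose
source it contains. -/
def Hereditary (G : CKGraph) (H : Set G.V) : Prop := ∀ e, G.s e ∈ H → G.r e ∈ H

/-- A set of vertices is saturated if it contains every regular vertex all of whose
emitted edges have range in the set. -/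
def Saturated (G : CKGraph) (H : Set G.V) : Prop :=
  ∀ v, G.Regular v → (∀ e, G.s e = v → G.r e ∈ H) → v ∈ H

/-- Move (S): removing the (regular) source `v` together with all edges it emits. -/
def removeSource (G : CKGraph) (v : G.V) (hsrc : G.IsSource v) : CKGraph where
  V := {w : G.V // w ≠ v}
  E := {e : G.E // G.s e ≠ v}
  r e := ⟨G.r e.1, hsrc e.1⟩
  s e := ⟨G.s e.1, e.2⟩

/-- Move (R): the reduction at a vertex `u` that emits exactly one edge `f` with
`r f ≠ u` and receives only from the single vertex `v`. -/
def reduce (G : CKGraph) (u : G.V) (f : G.E) (hf : G.s f = u) (hrf : G.r f ≠ u)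
    (honly : ∀ e, G.s e = u → e = f) (v : G.V) (hin : ∀ e, G.r e = u → G.s e = v) :
    CKGraph where
  V := {w : G.V // w ≠ u}
  E := {e : G.E // G.r e ≠ u ∧ e ≠ f} ⊕ {e : G.E // G.r e = u}
  r x :=
    match x with
    | .inl e => ⟨G.r e.1, e.2.1⟩
    | .inr _ => ⟨G.r f, hrf⟩
  s x :=
    match x with
    | .inl e => ⟨G.s e.1, fun h => e.2.2 (honly e.1 h)⟩
    | .inr e => ⟨G.s e.1, by
        intro h
        have h2 : G.r e.1 = u := e.2
        rw [honly e.1 h] at h2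
        exact hrf h2⟩

/-- Move (O): the out-split of `G` at `v` according to the partition of `s⁻¹(v)`
into the fibres of `P`. -/
noncomputable def outSplit (G : CKGraph) (v : G.V) (n : ℕ)
    (P : {e : G.E // G.s e = v} → Fin n) : CKGraph :=
  letI := Classical.decEq G.V
  { V := {w : G.V // w ≠ v} ⊕ Fin n
    E := {e : G.E // G.r e ≠ v} ⊕ ({e : G.E // G.r e = v} × Fin n)
    r := fun x =>
      match x with
      | .inl e => Sum.inl ⟨G.r e.1, e.2⟩
      | .inr p => Sum.inr p.2
    s := fun x =>
      match x with
      | .inl e =>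
          if h : G.s e.1 = v then Sum.inr (P ⟨e.1, h⟩) else Sum.inl ⟨G.s e.1, h⟩
      | .inr p =>
          if h : G.s p.1.1 = v then Sum.inr (P ⟨p.1.1, h⟩)
          else Sum.inl ⟨G.s p.1.1, h⟩ }

/-- Move (I): the in-split of `G` at `v` according to the partition of `r⁻¹(v)`
into the fibres of `P`. -/
noncomputable def inSplit (G : CKGraph) (v : G.V) (n : ℕ)
    (P : {e : G.E // G.r e = v} → Fin n) : CKGraph :=
  letI := Classical.decEq G.V
  { V := {w : G.V // w ≠ v} ⊕ Fin n
    E := {e : G.E // G.s e ≠ v} ⊕ ({e : G.E // G.s e = v} × Fin n)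
    s := fun x =>
      match x with
      | .inl e => Sum.inl ⟨G.s e.1, e.2⟩
      | .inr p => Sum.inr p.2
    r := fun x =>
      match x with
      | .inl e =>
          if h : G.r e.1 = v then Sum.inr (P ⟨e.1, h⟩) else Sum.inl ⟨G.r e.1, h⟩
      | .inr p =>
          if h : G.r p.1.1 = v then Sum.inr (P ⟨p.1.1, h⟩)
          else Sum.inl ⟨G.r p.1.1, h⟩ }

/-- Move-equivalence: the smallest equivalence relation on graphs with finitely many
vertices such that `G ∼ H` whenever `H` is obtained from `G`, up to graph
isomorphism, by one of the moves (S), (I), (O), (R). -/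
inductive MoveEquiv : CKGraph → CKGraph → Prop
  | of_iso {G H : CKGraph} (hG : Finite G.V) (h : Nonempty (Iso G H)) : MoveEquiv G H
  | moveS {G : CKGraph} (hG : Finite G.V) (v : G.V) (hreg : G.Regular v)
      (hsrc : G.IsSource v) {H : CKGraph}
      (h : Nonempty (Iso H (G.removeSource v hsrc))) : MoveEquiv G H
  | moveR {G : CKGraph} (hG : Finite G.V) (u : G.V) (f : G.E) (hf : G.s f = u)
      (hrf : G.r f ≠ u) (honly : ∀ e, G.s e = u → e = f) (v : G.V)
      (hin : ∀ e, G.r e = u → G.s e = v) {H : CKGraph}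
      (h : Nonempty (Iso H (G.reduce u f hf hrf honly v hin))) : MoveEquiv G H
  | moveO {G : CKGraph} (hG : Finite G.V) (v : G.V) (hns : ¬ G.IsSink v) (n : ℕ)
      (P : {e : G.E // G.s e = v} → Fin n) (hsurj : Function.Surjective P)
      (hinf : ∀ i j : Fin n, {x : {e : G.E // G.s e = v} | P x = i}.Infinite →
        {x : {e : G.E // G.s e = v} | P x = j}.Infinite → i = j)
      {H : CKGraph} (h : Nonempty (Iso H (G.outSplit v n P))) : MoveEquiv G H
  | moveI {G : CKGraph} (hG : Finite G.V) (v : G.V) (hreg : G.Regular v)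
      (hns : ¬ G.IsSource v) (n : ℕ) (P : {e : G.E // G.r e = v} → Fin n)
      (hsurj : Function.Surjective P) {H : CKGraph}
      (h : Nonempty (Iso H (G.inSplit v n P))) : MoveEquiv G H
  | symm {G H : CKGraph} : MoveEquiv G H → MoveEquiv H G
  | trans {G H K : CKGraph} : MoveEquiv G H → MoveEquiv H K → MoveEquiv G K

/-- The graph obtained from `G` by collapsing a regular non-source vertex `v` that
emits exactly one edge `f₀`, which is not a loop: delete `v`, `f₀` and all edges into
`v`, and add an edge `[e f₀]` from `s e` to `r f₀` for every edge `e` into `v`. -/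
def collapseOne (G : CKGraph) (v : G.V) (f₀ : G.E) (hf : G.s f₀ = v)
    (honly : ∀ e, G.s e = v → e = f₀) (hr : G.r f₀ ≠ v) : CKGraph where
  V := {w : G.V // w ≠ v}
  E := {e : G.E // G.r e ≠ v ∧ e ≠ f₀} ⊕ {e : G.E // G.r e = v}
  r x :=
    match x with
    | .inl e => ⟨G.r e.1, e.2.1⟩
    | .inr _ => ⟨G.r f₀, hr⟩
  s x :=
    match x with
    | .inl e => ⟨G.s e.1, fun h => e.2.2 (honly e.1 h)⟩
    | .inr e => ⟨G.s e.1, by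
        intro h
        have h2 : G.r e.1 = v := e.2
        rw [honly e.1 h] at h2
        exact hr h2⟩

/-- The graph obtained from `G` by collapsing a regular vertex `v` which does not
support a loop of length one: delete `v` and all edges into or out of `v`, and add
an edge `[e f]` from `s e` to `r f` for every pair of edges `e, f` with
`r e = v = s f`. -/
def collapse (G : CKGraph) (v : G.V) (hnl : ∀ e, G.s e = v → G.r e ≠ v) :
    CKGraph where
  V := {w : G.V // w ≠ v}
  E := {e : G.E // G.r e ≠ v ∧ G.s e ≠ v} ⊕
    ({e : G.E // G.r e = v} × {f : G.E // G.s f = v})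
  s x :=
    match x with
    | .inl e => ⟨G.s e.1, e.2.2⟩
    | .inr p => ⟨G.s p.1.1, fun h => hnl p.1.1 h p.1.2⟩
  r x :=
    match x with
    | .inl e => ⟨G.r e.1, e.2.1⟩
    | .inr p => ⟨G.r p.2.1, fun h => hnl p.2.1 p.2.2 h⟩

/-- The graph obtained from `G` by adding countably infinitely many new edges,
each with source `u` and range `w`. -/
def addEdges (G : CKGraph) (u w : G.V) : CKGraph where
  V := G.V
  E := G.E ⊕ ℕ
  r x := match x with | .inl e => G.r e | .inr _ => w
  s x := match x with | .inl e => G.s e | .inr _ => u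

/-- The graph with exactly one vertex and no edges. -/
def singletonGraph : CKGraph where
  V := PUnit
  E := Empty
  r e := e.elim
  s e := e.elim

/-- The Cuntz splice of `G` at `v`: add two new vertices `u₁, u₂` and six new edges:
`v → u₁`, `u₁ → v`, a loop at `u₁`, `u₁ → u₂`, `u₂ → u₁`, and a loop at `u₂`. -/
def cuntzSplice (G : CKGraph) (v : G.V) : CKGraph where
  V := G.V ⊕ Fin 2
  E := G.E ⊕ Fin 6
  s x :=
    match x with
    | .inl e => Sum.inl (G.s e)
    | .inr i => ![Sum.inl v, Sum.inr 0, Sum.inr 0, Sum.inr 0, Sum.inr 1, Sum.inr 1] i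
  r x :=
    match x with
    | .inl e => Sum.inl (G.r e)
    | .inr i => ![Sum.inr 0, Sum.inl v, Sum.inr 0, Sum.inr 1, Sum.inr 0, Sum.inr 1] i

/-- The adjacency matrix (as an integer matrix) of a graph whose vertices are
enumerated by `Fin n`. -/
noncomputable def adjMatrix (G : CKGraph) {n : ℕ} (ρ : G.V ≃ Fin n) :
    Matrix (Fin n) (Fin n) ℤ :=
  Matrix.of fun i j => (Nat.card {e : G.E // G.s e = ρ.symm i ∧ G.r e = ρ.symm j} : ℤ)

end CKGraph

/-- The graph of an `ℕ∞`-valued square matrix: it has exactly `A x y` edges from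
`x` to `y`. -/
def graphOfMatrix {n : ℕ} (A : Matrix (Fin n) (Fin n) ℕ∞) : CKGraph where
  V := Fin n
  E := Σ x : Fin n, Σ y : Fin n, {k : ℕ // (k : ℕ∞) < A x y}
  s e := e.1
  r e := e.2.1

/-- Move-equivalence of (possibly differently sized) square matrices over `ℕ∞`. -/
def MatMoveEquiv {m n : ℕ} (A : Matrix (Fin m) (Fin m) ℕ∞)
    (B : Matrix (Fin n) (Fin n) ℕ∞) : Prop :=
  CKGraph.MoveEquiv (graphOfMatrix A) (graphOfMatrix B)

/-- A square matrix is irreducible if any index connects to any other index through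
a chain of non-zero entries. -/
def MatIrreducible {n : ℕ} {α : Type*} [Zero α] (A : Matrix (Fin n) (Fin n) α) :
    Prop :=
  ∀ i j : Fin n, ∃ (l : ℕ) (c : ℕ → Fin n), 1 ≤ l ∧ c 0 = i ∧ c l = j ∧
    ∀ t < l, A (c t) (c (t + 1)) ≠ 0

/-- `Jmat n m` is the `n × n` matrix whose top-left `m × m` block is the identity,
whose other entries in the first `m` rows are `0`, and whose last `n - m` rows have
every entry equal to `∞`. -/
def Jmat (n m : ℕ) : Matrix (Fin n) (Fin n) ℕ∞ :=
  Matrix.of fun i j => if i.1 < m then (if i = j then 1 else 0) else ⊤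

namespace CKGraph

open Cardinal

/-- The number of edges from `u` to `w`, as a cardinal. -/
def mult (G : CKGraph) (u w : G.V) : Cardinal.{0} := #{e | G.s e = u ∧ G.r e = w}

theorem mult_congr {G H : CKGraph} {u w : G.V} {x y : H.V} (ρ : G.E → H.E)
    (h : Set.BijOn ρ {e | G.s e = u ∧ G.r e = w} {e | H.s e = x ∧ H.r e = y}) :
    G.mult u w = H.mult x y :=
  mk_congr (h.equiv ρ)

theorem mult_eq_zero {G : CKGraph} {u w : G.V} (h : ∀ e, G.s e = u → G.r e ≠ w) :
    G.mult u w = 0 :=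
  mk_eq_zero_iff.2 ⟨fun e => h e.1 e.2.1 e.2.2⟩

theorem nonempty_iso_of_mult_eq {G H : CKGraph} (φ : G.V ≃ H.V)
    (h : ∀ u w, G.mult u w = H.mult (φ u) (φ w)) : Nonempty (Iso G H) := by
  have hE (u w : G.V) : Nonempty ({e // G.s e = u ∧ G.r e = w} ≃
      {e // H.s e = φ u ∧ H.r e = φ w}) := Cardinal.eq.1 (h u w)
  have F (u w : G.V) := (hE u w).some
  refine ⟨⟨φ, Equiv.ofBijective (fun e => (F (G.s e) (G.r e) ⟨e, rfl, rfl⟩).1) ⟨?_, ?_⟩,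
    fun e => (F (G.s e) (G.r e) ⟨e, rfl, rfl⟩).2.2,
    fun e => (F (G.s e) (G.r e) ⟨e, rfl, rfl⟩).2.1⟩⟩
  · have key (u w : G.V) (p q : {e // G.s e = u ∧ G.r e = w})
        (hpq : (F u w p).1 = (F u w q).1) : p.1 = q.1 :=
      congrArg Subtype.val ((F u w).injective (Subtype.ext hpq))
    intro e e' hee
    have hs : G.s e' = G.s e := φ.injective <| by
      rw [← (F (G.s e) (G.r e) ⟨e, rfl, rfl⟩).2.1, ← (F (G.s e') (G.r e') ⟨e', rfl, rfl⟩).2.1]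
      exact congrArg H.s hee.symm
    have hr : G.r e' = G.r e := φ.injective <| by
      rw [← (F (G.s e) (G.r e) ⟨e, rfl, rfl⟩).2.2, ← (F (G.s e') (G.r e') ⟨e', rfl, rfl⟩).2.2]
      exact congrArg H.r hee.symm
    have move (u w : G.V) (hu : G.s e' = u) (hw : G.r e' = w) :
        (F (G.s e') (G.r e') ⟨e', rfl, rfl⟩).1 = (F u w ⟨e', hu, hw⟩).1 := by
      subst hu hw; rfl
    exact key _ _ ⟨e, rfl, rfl⟩ ⟨e', hs, hr⟩ (hee.trans (move _ _ hs hr))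
  · intro e
    obtain ⟨u, hu⟩ := φ.surjective (H.s e)
    obtain ⟨w, hw⟩ := φ.surjective (H.r e)
    obtain ⟨⟨d, rfl, rfl⟩, hd⟩ := (F u w).surjective ⟨e, hu.symm, hw.symm⟩
    exact ⟨d, congrArg Subtype.val hd⟩

theorem mult_collapse (G : CKGraph) (v : G.V) (hnl : ∀ e, G.s e = v → G.r e ≠ v)
    (u w : {x : G.V // x ≠ v}) :
    (G.collapse v hnl).mult u w = G.mult u w + G.mult u v * G.mult v w := by
  have e₁ : {x : (G.collapse v hnl).E //
        (G.collapse v hnl).s x = u ∧ (G.collapse v hnl).r x = w} ≃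
      {e : G.E // G.s e = u ∧ G.r e = w} ⊕
        ({e : G.E // G.s e = u ∧ G.r e = v} × {e : G.E // G.s e = v ∧ G.r e = w}) :=
    { toFun := fun x => match x with
        | ⟨.inl e, h⟩ => .inl ⟨e.1, congrArg Subtype.val h.1, congrArg Subtype.val h.2⟩
        | ⟨.inr p, h⟩ => .inr (⟨p.1.1, congrArg Subtype.val h.1, p.1.2⟩,
            ⟨p.2.1, p.2.2, congrArg Subtype.val h.2⟩)
      invFun := fun x => match x with
        | .inl e => ⟨.inl ⟨e.1, fun h => w.2 (e.2.2.symm.trans h),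
            fun h => u.2 (e.2.1.symm.trans h)⟩, Subtype.ext e.2.1, Subtype.ext e.2.2⟩
        | .inr p => ⟨.inr (⟨p.1.1, p.1.2.2⟩, ⟨p.2.1, p.2.2.1⟩),
            Subtype.ext p.1.2.1, Subtype.ext p.2.2.2⟩
      left_inv := by rintro ⟨_ | _, _⟩ <;> rfl
      right_inv := by rintro (_ | _) <;> rfl }
  exact (mk_congr e₁).trans (by rw [← add_def, ← mul_def]; rfl)

/-- If `H` arises from `G` by replacing `v` with two vertices `a` and `b` that together
carry the paths of length two through `v`, then collapsing `a` and `b` in `H` amounts to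
collapsing `v` in `G`. -/
theorem nonempty_iso_collapse_collapse {G H : CKGraph} (v : G.V)
    (hnl : ∀ e, G.s e = v → G.r e ≠ v) (a b : H.V) (hab : b ≠ a)
    (ι : {w : G.V // w ≠ v} → H.V) (hinj : Function.Injective ι)
    (ha : ∀ w, ι w ≠ a) (hb : ∀ w, ι w ≠ b) (hsurj : ∀ x, x = a ∨ x = b ∨ ∃ w, ι w = x)
    (hmult : ∀ u w, H.mult (ι u) (ι w) = G.mult u w)
    (hpath : ∀ u w, H.mult (ι u) a * H.mult a (ι w) + H.mult (ι u) b * H.mult b (ι w) =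
      G.mult u v * G.mult v w)
    (hnl' : ∀ e, (H.s e = a ∨ H.s e = b) → H.r e ≠ a ∧ H.r e ≠ b) :
    ∃ haa hbb, Nonempty
      (Iso (G.collapse v hnl) ((H.collapse a haa).collapse ⟨b, hab⟩ hbb)) := by
  have haa (e) (h : H.s e = a) : H.r e ≠ a := (hnl' e (Or.inl h)).1
  have hab₀ (e) (h : H.s e = a) : H.r e ≠ b := (hnl' e (Or.inl h)).2
  have hba₀ (e) (h : H.s e = b) : H.r e ≠ a := (hnl' e (Or.inr h)).1
  have hbb : ∀ e, (H.collapse a haa).s e = ⟨b, hab⟩ → (H.collapse a haa).r e ≠ ⟨b, hab⟩ := by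
    rintro (e | p) hs hr
    · exact (hnl' e.1 (Or.inr (congrArg Subtype.val hs))).2 (congrArg Subtype.val hr)
    · exact hab₀ p.2.1 p.2.2 (congrArg Subtype.val hr)
  refine ⟨haa, hbb, ?_⟩
  let φ : {w : G.V // w ≠ v} → ((H.collapse a haa).collapse ⟨b, hab⟩ hbb).V :=
    fun w => ⟨⟨ι w, ha w⟩, fun h => hb w (congrArg Subtype.val h)⟩
  have hφ : Function.Bijective φ := by
    refine ⟨fun x y h => hinj (congrArg (fun z => z.1.1) h), ?_⟩
    rintro ⟨⟨x, hxa⟩, hxb⟩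
    obtain rfl | rfl | ⟨w, rfl⟩ := hsurj x
    · exact absurd rfl hxa
    · exact absurd rfl hxb
    · exact ⟨w, rfl⟩
  refine nonempty_iso_of_mult_eq (Equiv.ofBijective φ hφ) fun u w => ?_
  change (G.collapse v hnl).mult u w =
    ((H.collapse a haa).collapse ⟨b, hab⟩ hbb).mult (φ u) (φ w)
  refine (mult_collapse G v hnl u w).trans (Eq.trans ?_
    (mult_collapse (H.collapse a haa) ⟨b, hab⟩ hbb (φ u) (φ w)).symm)
  refine Eq.trans ?_ (congrArg₂ (· + ·) (mult_collapse H a haa (φ u).1 (φ w).1)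
    (congrArg₂ (· * ·) (mult_collapse H a haa (φ u).1 ⟨b, hab⟩)
      (mult_collapse H a haa ⟨b, hab⟩ (φ w).1))).symm
  simp only [mult_eq_zero hab₀, mult_eq_zero hba₀, mul_zero, zero_mul, add_zero]
  change _ = H.mult (ι u) (ι w) + H.mult (ι u) a * H.mult a (ι w) +
    H.mult (ι u) b * H.mult b (ι w)
  rw [add_assoc]
  exact (congrArg₂ (· + ·) (hmult u w) (hpath u w)).symm

theorem finite_collapse {G : CKGraph} (hG : Finite G.V) (v : G.V)
    (hnl : ∀ e, G.s e = v → G.r e ≠ v) : Finite (G.collapse v hnl).V :=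
  inferInstanceAs (Finite {w : G.V // w ≠ v})

/-- Away from edges into `a`, collapsing `a` does not change the emitted edges. -/
theorem nonempty_equiv_out_collapse {G : CKGraph} (a b : G.V) (hab : b ≠ a)
    (haa : ∀ e, G.s e = a → G.r e ≠ a) (hba₀ : ∀ e, G.s e = b → G.r e ≠ a) :
    Nonempty ({e // (G.collapse a haa).s e = ⟨b, hab⟩} ≃ {e // G.s e = b}) :=
  ⟨{ toFun := fun x => match x with
      | ⟨.inl e, h⟩ => ⟨e.1, congrArg Subtype.val h⟩
      | ⟨.inr p, h⟩ => (hba₀ p.1.1 (congrArg Subtype.val h) p.1.2).elim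
     invFun := fun e => ⟨.inl ⟨e.1, hba₀ e.1 e.2, fun h => hab (e.2.symm.trans h)⟩,
      Subtype.ext e.2⟩
     left_inv := by
      rintro ⟨_ | p, h⟩
      · rfl
      · exact (hba₀ p.1.1 (congrArg Subtype.val h) p.1.2).elim
     right_inv := fun _ => rfl }⟩

/-- The set of vertices emitting an edge to `v`. -/
def inNeighbors (G : CKGraph) (v : G.V) : Set G.V := {u | ∃ e, G.s e = u ∧ G.r e = v}

theorem ncard_inNeighbors_collapse_le {G : CKGraph} (hG : Finite G.V) (a b : G.V)
    (hab : b ≠ a) (haa : ∀ e, G.s e = a → G.r e ≠ a) (hab₀ : ∀ e, G.s e = a → G.r e ≠ b) :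
    ((G.collapse a haa).inNeighbors ⟨b, hab⟩).ncard ≤ (G.inNeighbors b).ncard := by
  refine Set.ncard_le_ncard_of_injOn Subtype.val ?_ Subtype.val_injective.injOn
    (Set.toFinite _)
  rintro _ ⟨e | p, rfl, h⟩
  · exact ⟨e.1, rfl, congrArg Subtype.val h⟩
  · exact (hab₀ p.2.1 p.2.2 (congrArg Subtype.val h)).elim

/-- The graph with all edges reversed. -/
def op (G : CKGraph) : CKGraph where
  V := G.V
  E := G.E
  r := G.s
  s := G.r

theorem mult_op (G : CKGraph) (u w : G.V) : G.op.mult u w = G.mult w u :=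
  mk_congr (Equiv.subtypeEquivRight fun _ => and_comm)

section outSplit

variable (G : CKGraph) (v : G.V) (n : ℕ) (P : {e : G.E // G.s e = v} → Fin n)

/-- The map sending each vertex of an out-split to the vertex it came from. -/
def outSplitVertex : (G.outSplit v n P).V → G.V := Sum.elim Subtype.val fun _ => v

/-- The map sending each edge of an out-split to the edge it is a copy of. -/
def outSplitEdge : (G.outSplit v n P).E → G.E := Sum.elim Subtype.val fun p => p.1.1

variable {G v n P}

theorem outSplitVertex_s (x : (G.outSplit v n P).E) :
    G.outSplitVertex v n P ((G.outSplit v n P).s x) = G.s (G.outSplitEdge v n P x) := by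
  rcases x with x | x <;> simp only [outSplit, outSplitEdge, outSplitVertex] <;>
    split_ifs with h <;> simp [h]

theorem outSplitVertex_r (x : (G.outSplit v n P).E) :
    G.outSplitVertex v n P ((G.outSplit v n P).r x) = G.r (G.outSplitEdge v n P x) := by
  rcases x with x | x
  · rfl
  · exact x.1.2.symm

theorem outSplit_s_eq_inr_iff (x : (G.outSplit v n P).E) (i : Fin n) :
    (G.outSplit v n P).s x = Sum.inr i ↔
      ∃ h : G.s (G.outSplitEdge v n P x) = v, P ⟨G.outSplitEdge v n P x, h⟩ = i := by
  rcases x with x | x <;> simp only [outSplit, outSplitEdge, Sum.elim_inl, Sum.elim_inr] <;>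
    split_ifs with h <;> simp [h]

theorem outSplit_s_eq_inl_iff (x : (G.outSplit v n P).E) (u : {w : G.V // w ≠ v}) :
    (G.outSplit v n P).s x = Sum.inl u ↔ G.s (G.outSplitEdge v n P x) = u := by
  rw [← outSplitVertex_s]
  rcases (G.outSplit v n P).s x with w | i
  · exact Sum.inl_injective.eq_iff.trans Subtype.ext_iff
  · exact iff_of_false Sum.inr_ne_inl u.2.symm

theorem outSplitEdge_inj {x y : (G.outSplit v n P).E}
    (hr : (G.outSplit v n P).r x = (G.outSplit v n P).r y)
    (h : G.outSplitEdge v n P x = G.outSplitEdge v n P y) : x = y := by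
  rcases x with x | ⟨x, i⟩ <;> rcases y with y | ⟨y, j⟩ <;>
    simp_all [outSplit, outSplitEdge, Subtype.ext_iff]

theorem exists_outSplitEdge_eq (e : G.E) (y : (G.outSplit v n P).V)
    (h : G.outSplitVertex v n P y = G.r e) :
    ∃ x, G.outSplitEdge v n P x = e ∧ (G.outSplit v n P).r x = y := by
  rcases y with y | i
  · exact ⟨Sum.inl ⟨e, fun h' => y.2 (h.trans h')⟩, rfl, congrArg Sum.inl (Subtype.ext h.symm)⟩
  · exact ⟨Sum.inr (⟨e, h.symm⟩, i), rfl, rfl⟩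

theorem outSplit_r_ne (hnl : ∀ e, G.s e = v → G.r e ≠ v) (i j : Fin n)
    (x : (G.outSplit v n P).E) (hs : (G.outSplit v n P).s x = Sum.inr i) :
    (G.outSplit v n P).r x ≠ Sum.inr j := by
  intro hr
  refine hnl (G.outSplitEdge v n P x) ((outSplit_s_eq_inr_iff x i).1 hs).1 ?_
  rw [← outSplitVertex_r, hr]
  rfl

theorem mult_outSplit_inl (u : {w : G.V // w ≠ v}) (y : (G.outSplit v n P).V) :
    (G.outSplit v n P).mult (Sum.inl u) y = G.mult u (G.outSplitVertex v n P y) := by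
  refine mult_congr (G.outSplitEdge v n P) ⟨?_, ?_, ?_⟩
  · rintro x ⟨hs, rfl⟩
    exact ⟨(outSplit_s_eq_inl_iff x u).1 hs, (outSplitVertex_r x).symm⟩
  · rintro x ⟨-, hx⟩ y ⟨-, hy⟩ h
    exact outSplitEdge_inj (hx.trans hy.symm) h
  · rintro e ⟨hs, hr⟩
    obtain ⟨x, rfl, hx⟩ := exists_outSplitEdge_eq e y hr.symm
    exact ⟨x, ⟨(outSplit_s_eq_inl_iff x u).2 hs, hx⟩, rfl⟩

theorem mult_outSplit_inr_add {P : {e : G.E // G.s e = v} → Fin 2}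
    (y : (G.outSplit v 2 P).V) :
    (G.outSplit v 2 P).mult (Sum.inr 0) y + (G.outSplit v 2 P).mult (Sum.inr 1) y =
      G.mult v (G.outSplitVertex v 2 P y) := by
  have hdisj : Disjoint
      {x | (G.outSplit v 2 P).s x = Sum.inr 0 ∧ (G.outSplit v 2 P).r x = y}
      {x | (G.outSplit v 2 P).s x = Sum.inr 1 ∧ (G.outSplit v 2 P).r x = y} := by
    refine Set.disjoint_left.2 fun x hx hx' => ?_
    have h := Sum.inr_injective (hx.1.symm.trans hx'.1)
    exact absurd h (by decide)
  refine (mk_union_of_disjoint hdisj).symm.trans (mk_congr ?_)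
  refine Set.BijOn.equiv (G.outSplitEdge v 2 P) ⟨?_, ?_, ?_⟩
  · rintro x (⟨hs, rfl⟩ | ⟨hs, rfl⟩) <;>
      exact ⟨((outSplit_s_eq_inr_iff x _).1 hs).1, (outSplitVertex_r x).symm⟩
  · rintro x hx y' hy h
    refine outSplitEdge_inj ?_ h
    rcases hx with hx | hx <;> rcases hy with hy | hy <;> exact hx.2.trans hy.2.symm
  · rintro e ⟨hs, hr⟩
    obtain ⟨x, rfl, hx⟩ := exists_outSplitEdge_eq e y hr.symm
    refine ⟨x, ?_, rfl⟩
    rcases Fin.exists_fin_two.1 ⟨P ⟨_, hs⟩, rfl⟩ with h | h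
    · exact Or.inl ⟨(outSplit_s_eq_inr_iff x _).2 ⟨hs, h⟩, hx⟩
    · exact Or.inr ⟨(outSplit_s_eq_inr_iff x _).2 ⟨hs, h⟩, hx⟩

theorem card_out_outSplit (hnl : ∀ e, G.s e = v → G.r e ≠ v) (i : Fin n) :
    Nat.card {x // (G.outSplit v n P).s x = Sum.inr i} = Nat.card {e // P e = i} := by
  refine Nat.card_congr (Equiv.ofBijective (fun x => ⟨⟨G.outSplitEdge v n P x.1,
    ((outSplit_s_eq_inr_iff x.1 i).1 x.2).1⟩, ((outSplit_s_eq_inr_iff x.1 i).1 x.2).2⟩) ⟨?_, ?_⟩)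
  · rintro ⟨x | x, hx⟩ ⟨y | y, hy⟩ h
    · exact Subtype.ext (congrArg Sum.inl (Subtype.ext (congrArg (fun z => z.1.1) h)))
    · exact (outSplit_r_ne hnl i _ _ hy rfl).elim
    · exact (outSplit_r_ne hnl i _ _ hx rfl).elim
    · exact (outSplit_r_ne hnl i _ _ hx rfl).elim
  · rintro ⟨⟨e, he⟩, hP⟩
    exact ⟨⟨Sum.inl ⟨e, hnl e he⟩, (outSplit_s_eq_inr_iff _ i).2 ⟨he, hP⟩⟩, rfl⟩

theorem card_in_outSplit (i : Fin n) :
    Nat.card {x // (G.outSplit v n P).r x = Sum.inr i} = Nat.card {e // G.r e = v} := by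
  refine Nat.card_congr (Equiv.ofBijective (fun x => ⟨G.outSplitEdge v n P x.1,
    (outSplitVertex_r x.1).symm.trans (congrArg _ x.2)⟩) ⟨?_, ?_⟩)
  · intro x y h
    exact Subtype.ext (outSplitEdge_inj (x.2.trans y.2.symm) (congrArg Subtype.val h))
  · rintro ⟨e, he⟩
    exact ⟨⟨Sum.inr (⟨e, he⟩, i), rfl⟩, rfl⟩

end outSplit

section inSplit

variable {G : CKGraph} {v : G.V} {n : ℕ} {P : {e : G.E // G.r e = v} → Fin n}

theorem inSplit_r (x : (G.inSplit v n P).E) :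
    (G.inSplit v n P).r x = (outSplit G.op v n P).s x := by
  rcases x with x | x <;> rfl

theorem inSplit_s (x : (G.inSplit v n P).E) :
    (G.inSplit v n P).s x = (outSplit G.op v n P).r x := by
  rcases x with x | x <;> rfl

theorem mult_inSplit (x y : (G.inSplit v n P).V) :
    (G.inSplit v n P).mult x y = (outSplit G.op v n P).mult y x :=
  mk_congr (Equiv.subtypeEquivRight fun e => and_comm.trans <|
    and_congr (iff_of_eq (congrArg (· = y) (inSplit_r e)))
      (iff_of_eq (congrArg (· = x) (inSplit_s e))))

theorem inSplit_r_ne (hnl : ∀ e, G.s e = v → G.r e ≠ v) (i j : Fin n)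
    (x : (G.inSplit v n P).E) (hs : (G.inSplit v n P).s x = Sum.inr i) :
    (G.inSplit v n P).r x ≠ Sum.inr j := fun hr =>
  outSplit_r_ne (G := G.op) (P := P) (fun e hr hs => hnl e hs hr) j i x
    ((inSplit_r x).symm.trans hr) ((inSplit_s x).symm.trans hs)

theorem card_out_inSplit (i : Fin n) :
    Nat.card {x // (G.inSplit v n P).s x = Sum.inr i} = Nat.card {e // G.s e = v} :=
  (Nat.card_congr (Equiv.subtypeEquivRight fun x =>
    iff_of_eq (congrArg (· = Sum.inr i) (inSplit_s x)))).trans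
    (card_in_outSplit (G := G.op) (P := P) i)

theorem ncard_inNeighbors_inSplit_lt (hG : Finite G.V) (hnl : ∀ e, G.s e = v → G.r e ≠ v)
    (i : Fin n) {u : G.V} (hu : u ∈ G.inNeighbors v) (hne : ∀ e, P e = i → G.s e.1 ≠ u) :
    ((G.inSplit v n P).inNeighbors (Sum.inr i)).ncard < (G.inNeighbors v).ncard := by
  refine lt_of_le_of_lt ?_ (Set.ncard_sdiff_singleton_lt_of_mem hu (Set.toFinite _))
  refine Set.ncard_le_ncard_of_injOn (outSplitVertex G.op v n P) ?_ ?_ (Set.toFinite _)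
  · rintro _ ⟨x, rfl, hr⟩
    obtain ⟨h, hP⟩ := (outSplit_s_eq_inr_iff (G := G.op) x i).1 ((inSplit_r x).symm.trans hr)
    have hs : outSplitVertex G.op v n P ((G.inSplit v n P).s x) =
        G.s (outSplitEdge G.op v n P x) :=
      (congrArg _ (inSplit_s x)).trans (outSplitVertex_r (G := G.op) x)
    rw [hs]
    exact ⟨⟨_, rfl, h⟩, hne _ hP⟩
  · rintro (x | j) ⟨e, hs, hr⟩ (y | k) ⟨e', hs', hr'⟩ h
    · exact congrArg Sum.inl (Subtype.ext h)
    · exact (inSplit_r_ne hnl _ _ _ hs' hr').elim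
    · exact (inSplit_r_ne hnl _ _ _ hs hr).elim
    · exact (inSplit_r_ne hnl _ _ _ hs hr).elim

end inSplit

theorem moveEquiv_collapse_of_outSplit {G : CKGraph} (hG : Finite G.V) {v : G.V}
    (hnl : ∀ e, G.s e = v → G.r e ≠ v) {P : {e : G.E // G.s e = v} → Fin 2}
    (hsplit : MoveEquiv G (G.outSplit v 2 P))
    (h₀ : ∀ haa, MoveEquiv (G.outSplit v 2 P) ((G.outSplit v 2 P).collapse (Sum.inr 0) haa))
    (h₁ : ∀ haa hab hbb, MoveEquiv ((G.outSplit v 2 P).collapse (Sum.inr 0) haa)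
      (((G.outSplit v 2 P).collapse (Sum.inr 0) haa).collapse ⟨Sum.inr 1, hab⟩ hbb)) :
    MoveEquiv G (G.collapse v hnl) := by
  have hab : (Sum.inr 1 : {w : G.V // w ≠ v} ⊕ Fin 2) ≠ Sum.inr 0 := by simp
  obtain ⟨haa, hbb, hiso⟩ := nonempty_iso_collapse_collapse (H := G.outSplit v 2 P) v hnl
    (Sum.inr 0) (Sum.inr 1) hab Sum.inl Sum.inl_injective (fun _ => Sum.inl_ne_inr)
    (fun _ => Sum.inl_ne_inr)
    (by
      rintro (w | i)
      · exact Or.inr (Or.inr ⟨w, rfl⟩)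
      · fin_cases i
        · exact Or.inl rfl
        · exact Or.inr (Or.inl rfl))
    (fun u w => mult_outSplit_inl u _)
    (fun u w => (congrArg₂ (· + ·) (congrArg (· * _) (mult_outSplit_inl u (Sum.inr 0)))
      (congrArg (· * _) (mult_outSplit_inl u (Sum.inr 1)))).trans
        ((mul_add _ _ _).symm.trans (congrArg _ (mult_outSplit_inr_add (Sum.inl w)))))
    (by
      rintro e (h | h) <;>
        exact ⟨outSplit_r_ne hnl _ _ _ h, outSplit_r_ne hnl _ _ _ h⟩)
  exact (hsplit.trans ((h₀ haa).trans (h₁ haa hab hbb))).trans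
    (.symm (.of_iso (finite_collapse hG v hnl) hiso))

theorem moveEquiv_collapse_of_inSplit {G : CKGraph} (hG : Finite G.V) {v : G.V}
    (hnl : ∀ e, G.s e = v → G.r e ≠ v) {P : {e : G.E // G.r e = v} → Fin 2}
    (hsplit : MoveEquiv G (G.inSplit v 2 P))
    (h₀ : ∀ haa, MoveEquiv (G.inSplit v 2 P) ((G.inSplit v 2 P).collapse (Sum.inr 0) haa))
    (h₁ : ∀ haa hab hbb, MoveEquiv ((G.inSplit v 2 P).collapse (Sum.inr 0) haa)
      (((G.inSplit v 2 P).collapse (Sum.inr 0) haa).collapse ⟨Sum.inr 1, hab⟩ hbb)) :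
    MoveEquiv G (G.collapse v hnl) := by
  have hab : (Sum.inr 1 : {w : G.V // w ≠ v} ⊕ Fin 2) ≠ Sum.inr 0 := by simp
  have hinl (w : {w : G.V // w ≠ v}) (y : (G.inSplit v 2 P).V) :
      (G.inSplit v 2 P).mult y (Sum.inl w) = G.mult (outSplitVertex G.op v 2 P y) w :=
    (mult_inSplit _ _).trans ((mult_outSplit_inl (G := G.op) w y).trans (mult_op _ _ _))
  have hinr (u : {w : G.V // w ≠ v}) : (G.inSplit v 2 P).mult (Sum.inl u) (Sum.inr 0) +
      (G.inSplit v 2 P).mult (Sum.inl u) (Sum.inr 1) = G.mult u v :=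
    (congrArg₂ (· + ·) (mult_inSplit (Sum.inl u) (Sum.inr 0))
      (mult_inSplit (Sum.inl u) (Sum.inr 1))).trans
        ((mult_outSplit_inr_add (G := G.op) (P := P) (Sum.inl u)).trans (mult_op _ _ _))
  obtain ⟨haa, hbb, hiso⟩ := nonempty_iso_collapse_collapse (H := G.inSplit v 2 P) v hnl
    (Sum.inr 0) (Sum.inr 1) hab Sum.inl Sum.inl_injective (fun _ => Sum.inl_ne_inr)
    (fun _ => Sum.inl_ne_inr)
    (by
      rintro (w | i)
      · exact Or.inr (Or.inr ⟨w, rfl⟩)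
      · fin_cases i
        · exact Or.inl rfl
        · exact Or.inr (Or.inl rfl))
    (fun u w => hinl w _)
    (fun u w => (congrArg₂ (· + ·) (congrArg (_ * ·) (hinl w (Sum.inr 0)))
      (congrArg (_ * ·) (hinl w (Sum.inr 1)))).trans
        ((add_mul _ _ _).symm.trans (congrArg (· * _) (hinr u))))
    (by
      rintro e (h | h) <;>
        exact ⟨inSplit_r_ne hnl _ _ _ h, inSplit_r_ne hnl _ _ _ h⟩)
  exact (hsplit.trans ((h₀ haa).trans (h₁ haa hab hbb))).trans
    (.symm (.of_iso (finite_collapse hG v hnl) hiso))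

/-- Collapsing a vertex that emits exactly one edge and receives edges from at most one
vertex is an instance of move (R). -/
theorem moveEquiv_collapse_of_subsingleton_inNeighbors {G : CKGraph} (hG : Finite G.V)
    (v : G.V) (hnl : ∀ e, G.s e = v → G.r e ≠ v) (hout : Nat.card {e // G.s e = v} = 1)
    (hin : (G.inNeighbors v).Subsingleton) : MoveEquiv G (G.collapse v hnl) := by
  obtain ⟨⟨f, hf⟩, hf'⟩ := Nat.card_eq_one_iff_exists.1 hout
  have honly (e : G.E) (h : G.s e = v) : e = f := congrArg Subtype.val (hf' ⟨e, h⟩)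
  obtain ⟨u, hu⟩ : ∃ u, ∀ e, G.r e = v → G.s e = u := by
    by_cases h : ∃ e, G.r e = v
    · obtain ⟨e₀, h₀⟩ := h
      exact ⟨G.s e₀, fun e he => hin ⟨e, rfl, he⟩ ⟨e₀, rfl, h₀⟩⟩
    · exact ⟨v, fun e he => (h ⟨e, he⟩).elim⟩
  have hE (e : G.E) : (G.r e ≠ v ∧ G.s e ≠ v) ↔ (G.r e ≠ v ∧ e ≠ f) :=
    and_congr_right fun _ => not_congr ⟨honly e, fun h => h ▸ hf⟩
  let _ : Unique {e // G.s e = v} := ⟨⟨⟨f, hf⟩⟩, hf'⟩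
  refine .moveR hG v f hf (hnl f hf) honly u hu ⟨⟨Equiv.refl _,
    Equiv.sumCongr (Equiv.subtypeEquivRight hE) (Equiv.prodUnique _ _), ?_, ?_⟩⟩
  · rintro (e | ⟨e, d⟩)
    · rfl
    · exact Subtype.ext (congrArg G.r (honly d.1 d.2).symm)
  · rintro (e | ⟨e, d⟩) <;> rfl

/-- Collapsing a vertex that emits exactly one edge, by in-splitting it according to the
sources of the edges it receives. -/
theorem moveEquiv_collapse_of_card_out_eq_one {G : CKGraph} (hG : Finite G.V)
    (v : G.V) (hnl : ∀ e, G.s e = v → G.r e ≠ v) (hout : Nat.card {e // G.s e = v} = 1) :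
    MoveEquiv G (G.collapse v hnl) := by
  induction hk : (G.inNeighbors v).ncard using Nat.strong_induction_on generalizing G with
  | _ k ih =>
    subst hk
    by_cases hin : (G.inNeighbors v).Subsingleton
    · exact moveEquiv_collapse_of_subsingleton_inNeighbors hG v hnl hout hin
    obtain ⟨_, ⟨e₀, rfl, h₀⟩, _, ⟨e₁, rfl, h₁⟩, hne⟩ := Set.not_subsingleton_iff.1 hin
    classical
    let P : {e : G.E // G.r e = v} → Fin 2 := fun e => if G.s e.1 = G.s e₀ then 0 else 1
    have hlt : ∀ i, ((G.inSplit v 2 P).inNeighbors (Sum.inr i)).ncard <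
        (G.inNeighbors v).ncard := by
      refine Fin.forall_fin_two.2 ⟨?_, ?_⟩
      · refine ncard_inNeighbors_inSplit_lt hG hnl 0 ⟨e₁, rfl, h₁⟩ fun e he h => ?_
        simp [P, h, hne.symm] at he
      · refine ncard_inNeighbors_inSplit_lt hG hnl 1 ⟨e₀, rfl, h₀⟩ fun e he h => ?_
        simp [P, h] at he
    have hH : Finite (G.inSplit v 2 P).V :=
      inferInstanceAs (Finite ({w : G.V // w ≠ v} ⊕ Fin 2))
    have hreg : G.Regular v := by
      obtain ⟨_, ⟨⟨f, hf⟩⟩⟩ := Nat.card_eq_one_iff_unique.1 hout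
      exact ⟨⟨f, hf⟩, Nat.finite_of_card_ne_zero (hout ▸ one_ne_zero)⟩
    refine moveEquiv_collapse_of_inSplit hG hnl (P := P) ?_ (fun haa => ?_)
      fun haa hab hbb => ?_
    · refine .moveI hG v hreg (fun h => h e₀ h₀) 2 P
        (Fin.forall_fin_two.2 ⟨⟨⟨e₀, h₀⟩, by simp [P]⟩, ⟨⟨e₁, h₁⟩, by simp [P, hne.symm]⟩⟩)
        ⟨⟨Equiv.refl _, Equiv.refl _, fun _ => rfl, fun _ => rfl⟩⟩
    · exact ih _ (hlt 0) hH (Sum.inr 0) haa ((card_out_inSplit 0).trans hout) rfl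
    · refine ih _ (lt_of_le_of_lt ?_ (hlt 1)) (finite_collapse hH _ haa) _ hbb ?_ rfl
      · exact ncard_inNeighbors_collapse_le hH _ _ hab haa (inSplit_r_ne hnl 0 1)
      · obtain ⟨φ⟩ := nonempty_equiv_out_collapse (G := G.inSplit v 2 P) _ _ hab haa
          (inSplit_r_ne hnl 1 0)
        exact (Nat.card_congr φ).trans ((card_out_inSplit 1).trans hout)

/-- Collapsing a regular vertex, by out-splitting it until each of the resulting vertices
emits exactly one edge. -/
theorem moveEquiv_collapse_of_card_out_ne_zero {G : CKGraph} (hG : Finite G.V)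
    (v : G.V) (hnl : ∀ e, G.s e = v → G.r e ≠ v) (hout : Nat.card {e // G.s e = v} ≠ 0) :
    MoveEquiv G (G.collapse v hnl) := by
  induction hk : Nat.card {e // G.s e = v} using Nat.strong_induction_on generalizing G with
  | _ k ih =>
    subst hk
    by_cases hone : Nat.card {e // G.s e = v} = 1
    · exact moveEquiv_collapse_of_card_out_eq_one hG v hnl hone
    have hfin : Finite {e // G.s e = v} := Nat.finite_of_card_ne_zero hout
    obtain ⟨e₀, e₁, hne⟩ := Finite.one_lt_card_iff_nontrivial.1
      (show 1 < Nat.card {e // G.s e = v} by omega)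
    classical
    let P : {e : G.E // G.s e = v} → Fin 2 := fun e => if e = e₀ then 0 else 1
    have hP₀ : P e₀ = 0 := by simp [P]
    have hP₁ : P e₁ = 1 := by simp [P, hne.symm]
    have hlt : ∀ i, Nat.card {x // (G.outSplit v 2 P).s x = Sum.inr i} <
        Nat.card {e // G.s e = v} := by
      refine Fin.forall_fin_two.2 ⟨?_, ?_⟩ <;> rw [card_out_outSplit hnl]
      · exact Finite.card_subtype_lt (x := e₁) (by simp [hP₁])
      · exact Finite.card_subtype_lt (x := e₀) (by simp [hP₀])
    have hpos : ∀ i, Nat.card {x // (G.outSplit v 2 P).s x = Sum.inr i} ≠ 0 := by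
      refine Fin.forall_fin_two.2 ⟨?_, ?_⟩ <;>
        rw [card_out_outSplit hnl, Nat.card_ne_zero]
      · exact ⟨⟨e₀, hP₀⟩, inferInstance⟩
      · exact ⟨⟨e₁, hP₁⟩, inferInstance⟩
    have hH : Finite (G.outSplit v 2 P).V :=
      inferInstanceAs (Finite ({w : G.V // w ≠ v} ⊕ Fin 2))
    refine moveEquiv_collapse_of_outSplit hG hnl (P := P) ?_ (fun haa => ?_)
      fun haa hab hbb => ?_
    · refine .moveO hG v (fun h => h e₀.1 e₀.2) 2 P
        (Fin.forall_fin_two.2 ⟨⟨e₀, hP₀⟩, ⟨e₁, hP₁⟩⟩)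
        (fun i j hi => (hi (Set.toFinite _)).elim)
        ⟨⟨Equiv.refl _, Equiv.refl _, fun _ => rfl, fun _ => rfl⟩⟩
    · exact ih _ (hlt 0) hH (Sum.inr 0) haa (hpos 0) rfl
    · obtain ⟨φ⟩ := nonempty_equiv_out_collapse (G := G.outSplit v 2 P) _ _ hab haa
        (outSplit_r_ne hnl 1 0)
      have hφ := Nat.card_congr φ
      exact ih _ (hφ.trans_lt (hlt 1)) (finite_collapse hH _ haa) _ hbb
        (hφ.trans_ne (hpos 1)) rfl

end CKGraph

/-- Collapse: collapsing a regular vertex that does not support a loop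
of length one preserves move-equivalence. -/
theorem stmt1 (G : CKGraph) (hfin : Finite G.V) (v : G.V) (hreg : G.Regular v)
    (hnl : ∀ e, G.s e = v → G.r e ≠ v) :
    CKGraph.MoveEquiv G (G.collapse v hnl) := by
  obtain ⟨⟨e, he⟩, hout⟩ := hreg
  have : Finite {e // G.s e = v} := hout
  exact CKGraph.moveEquiv_collapse_of_card_out_ne_zero hfin v hnl
    (Nat.card_ne_zero.2 ⟨⟨e, he⟩, this⟩)
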